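/- arXiv:math/0301069 — 13 statements merged into one kernel-verified Lean document; each statement's English description precedes it below -/
import Mathlib

section
/- Let R be a curvature-type tensor on V and let D : V × V → End(V) be a bilinear map such that each endomorphism D(X,Y) is skew-symmetric and anticommutes with J, and such that R(X,Y,Z,U) − R(X,Y,JZ,JU) = 2⟨D(X,Y)Z, U⟩ for all X,Y,Z,U ∈ V. If R satisfies Gray's third curvature condition R(JX,JY,JZ,JU) = R(X,Y,Z,U) for all X,Y,Z,U, then ⟨D(Z,U)X, Y⟩ = ⟨D(X,Y)Z, U⟩ and D(JX,JY) = −D(X,Y) for all X,Y,Z,U ∈ V. (Pointwise algebraic form of Lemma 3.1.) -/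
open scoped RealInnerProductSpace

/-- Pointwise algebraic form of Lemma 3.1: for a curvature-type tensor `R` satisfying Gray's
third condition, the bilinear map `D` with skew-symmetric, `J`-anticommuting values and
`R(X,Y,Z,U) − R(X,Y,JZ,JU) = 2⟨D(X,Y)Z, U⟩` is symmetric in the pairs and `J`-anti-invariant. -/
theorem stmt_0
    {V : Type*} [NormedAddCommGroup V] [InnerProductSpace ℝ V] [FiniteDimensional ℝ V]
    (J : V →ₗ[ℝ] V)
    (hJiso : ∀ x y : V, ⟪J x, J y⟫ = ⟪x, y⟫)
    (hJ2 : ∀ x : V, J (J x) = -x)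
    (R : V →ₗ[ℝ] V →ₗ[ℝ] V →ₗ[ℝ] V →ₗ[ℝ] ℝ)
    (hR1 : ∀ X Y Z U : V, R X Y Z U = - R Y X Z U)
    (hR2 : ∀ X Y Z U : V, R X Y Z U = - R X Y U Z)
    (hR3 : ∀ X Y Z U : V, R X Y Z U = R Z U X Y)
    (D : V →ₗ[ℝ] V →ₗ[ℝ] (V →ₗ[ℝ] V))
    (hDskew : ∀ X Y x y : V, ⟪D X Y x, y⟫ = -⟪x, D X Y y⟫)
    (hDanti : ∀ X Y x : V, D X Y (J x) = - J (D X Y x))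
    (hRD : ∀ X Y Z U : V, R X Y Z U - R X Y (J Z) (J U) = 2 * ⟪D X Y Z, U⟫)
    (hG3 : ∀ X Y Z U : V, R (J X) (J Y) (J Z) (J U) = R X Y Z U) :
    (∀ X Y Z U : V, ⟪D Z U X, Y⟫ = ⟪D X Y Z, U⟫) ∧
    (∀ X Y : V, D (J X) (J Y) = - D X Y) := by
  have hmove : ∀ X Y Z U : V, R (J X) (J Y) Z U = R X Y (J Z) (J U) := fun X Y Z U => by
    simpa [hJ2] using hG3 X Y (J Z) (J U)
  refine ⟨fun X Y Z U => ?_, fun X Y => LinearMap.ext fun Z => ext_inner_right ℝ fun U => ?_⟩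
  · linarith [hRD Z U X Y, hRD X Y Z U, hR3 Z U X Y, hR3 Z U (J X) (J Y), hmove X Y Z U]
  · rw [LinearMap.neg_apply, inner_neg_left]
    linarith [hRD (J X) (J Y) Z U, hRD X Y Z U, hG3 X Y Z U, hmove X Y Z U]
end

section
/- Let R be a curvature-type tensor on V satisfying Gray's third condition R(JX,JY,JZ,JU) = R(X,Y,Z,U), let D : V × V → End(V) be bilinear with each D(X,Y) skew-symmetric and anticommuting with J and with R(X,Y,Z,U) − R(X,Y,JZ,JU) = 2⟨D(X,Y)Z, U⟩ for all X,Y,Z,U, and let η be a torsion-type tensor on V. Define R̄(X,Y,Z,U) = R(X,Y,Z,U) + ⟨[η_X,η_Y]Z, U⟩ − ⟨D(X,Y)Z, U⟩. Then R̄(X,Y,Z,U) − R̄(Z,U,X,Y) = ⟨[η_X,η_Y]Z, U⟩ − ⟨[η_Z,η_U]X, Y⟩ for all X,Y,Z,U ∈ V. (Pointwise algebraic form of Corollary 3.1(i).) -/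
open scoped RealInnerProductSpace

/-- Pointwise algebraic form of Corollary 3.1(i): for the canonical Hermitian curvature
`R̄(X,Y,Z,U) = R(X,Y,Z,U) + ⟨[η_X,η_Y]Z,U⟩ − ⟨D(X,Y)Z,U⟩` one has
`R̄(X,Y,Z,U) − R̄(Z,U,X,Y) = ⟨[η_X,η_Y]Z,U⟩ − ⟨[η_Z,η_U]X,Y⟩`. -/
theorem stmt_1
    {V : Type*} [NormedAddCommGroup V] [InnerProductSpace ℝ V] [FiniteDimensional ℝ V]
    (J : V →ₗ[ℝ] V)
    (hJiso : ∀ x y : V, ⟪J x, J y⟫ = ⟪x, y⟫)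
    (hJ2 : ∀ x : V, J (J x) = -x)
    -- R is a curvature-type tensor
    (R : V →ₗ[ℝ] V →ₗ[ℝ] V →ₗ[ℝ] V →ₗ[ℝ] ℝ)
    (hR1 : ∀ X Y Z U : V, R X Y Z U = - R Y X Z U)
    (hR2 : ∀ X Y Z U : V, R X Y Z U = - R X Y U Z)
    (hR3 : ∀ X Y Z U : V, R X Y Z U = R Z U X Y)
    -- Gray's third condition
    (hG3 : ∀ X Y Z U : V, R (J X) (J Y) (J Z) (J U) = R X Y Z U)
    -- D is bilinear with skew-symmetric, J-anticommuting values
    (D : V →ₗ[ℝ] V →ₗ[ℝ] (V →ₗ[ℝ] V))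
    (hDskew : ∀ X Y x y : V, ⟪D X Y x, y⟫ = -⟪x, D X Y y⟫)
    (hDanti : ∀ X Y x : V, D X Y (J x) = - J (D X Y x))
    (hRD : ∀ X Y Z U : V, R X Y Z U - R X Y (J Z) (J U) = 2 * ⟪D X Y Z, U⟫)
    -- η is a torsion-type tensor
    (η : V →ₗ[ℝ] (V →ₗ[ℝ] V))
    (hηskew : ∀ X x y : V, ⟪η X x, y⟫ = -⟪x, η X y⟫)
    (hηanti : ∀ X x : V, η X (J x) = - J (η X x))
    -- definition of R̄
    (Rb : V → V → V → V → ℝ)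
    (hRb : ∀ X Y Z U : V, Rb X Y Z U =
      R X Y Z U + ⟪η X (η Y Z) - η Y (η X Z), U⟫ - ⟪D X Y Z, U⟫) :
    ∀ X Y Z U : V, Rb X Y Z U - Rb Z U X Y =
      ⟪η X (η Y Z) - η Y (η X Z), U⟫ - ⟪η Z (η U X) - η U (η Z X), Y⟫ := by
  intro X Y Z U
  have hJ : R X Y (J Z) (J U) = R Z U (J X) (J Y) := by
    rw [← hG3 X Y (J Z) (J U), hJ2, hJ2, hR3 Z U]
    simp
  have hXY := hRD X Y Z U
  have hZU := hRD Z U X Y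
  rw [hRb, hRb]
  linarith [hR3 X Y Z U]
end

section
/- Let R be a curvature-type tensor on V satisfying Gray's third condition R(JX,JY,JZ,JU) = R(X,Y,Z,U), let D : V × V → End(V) be bilinear with each D(X,Y) skew-symmetric and anticommuting with J and with R(X,Y,Z,U) − R(X,Y,JZ,JU) = 2⟨D(X,Y)Z, U⟩ for all X,Y,Z,U, and let η be a quasi-Kähler torsion-type tensor on V. Define R̄(X,Y,Z,U) = R(X,Y,Z,U) + ⟨[η_X,η_Y]Z, U⟩ − ⟨D(X,Y)Z, U⟩. Then R̄(JX,JY,Z,U) = R̄(X,Y,Z,U) for all X,Y,Z,U ∈ V. (Pointwise algebraic form of Corollary 3.1(ii).) -/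
open scoped RealInnerProductSpace

/-- Pointwise algebraic form of Corollary 3.1(ii): for a quasi-Kähler torsion-type tensor `η`
and the canonical Hermitian curvature `R̄(X,Y,Z,U) = R(X,Y,Z,U) + ⟨[η_X,η_Y]Z,U⟩ − ⟨D(X,Y)Z,U⟩`
one has `R̄(JX,JY,Z,U) = R̄(X,Y,Z,U)`. -/
theorem stmt_2
    {V : Type*} [NormedAddCommGroup V] [InnerProductSpace ℝ V] [FiniteDimensional ℝ V]
    (J : V →ₗ[ℝ] V)
    (hJiso : ∀ x y : V, ⟪J x, J y⟫ = ⟪x, y⟫)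
    (hJ2 : ∀ x : V, J (J x) = -x)
    -- R is a curvature-type tensor
    (R : V →ₗ[ℝ] V →ₗ[ℝ] V →ₗ[ℝ] V →ₗ[ℝ] ℝ)
    (hR1 : ∀ X Y Z U : V, R X Y Z U = - R Y X Z U)
    (hR2 : ∀ X Y Z U : V, R X Y Z U = - R X Y U Z)
    (hR3 : ∀ X Y Z U : V, R X Y Z U = R Z U X Y)
    -- Gray's third condition
    (hG3 : ∀ X Y Z U : V, R (J X) (J Y) (J Z) (J U) = R X Y Z U)
    -- D is bilinear with skew-symmetric, J-anticommuting values
    (D : V →ₗ[ℝ] V →ₗ[ℝ] (V →ₗ[ℝ] V))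
    (hDskew : ∀ X Y x y : V, ⟪D X Y x, y⟫ = -⟪x, D X Y y⟫)
    (hDanti : ∀ X Y x : V, D X Y (J x) = - J (D X Y x))
    (hRD : ∀ X Y Z U : V, R X Y Z U - R X Y (J Z) (J U) = 2 * ⟪D X Y Z, U⟫)
    -- η is a quasi-Kähler torsion-type tensor
    (η : V →ₗ[ℝ] (V →ₗ[ℝ] V))
    (hηskew : ∀ X x y : V, ⟪η X x, y⟫ = -⟪x, η X y⟫)
    (hηanti : ∀ X x : V, η X (J x) = - J (η X x))
    (hηQK : ∀ X x : V, η (J X) x = - J (η X x))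
    -- definition of R̄
    (Rb : V → V → V → V → ℝ)
    (hRb : ∀ X Y Z U : V, Rb X Y Z U =
      R X Y Z U + ⟪η X (η Y Z) - η Y (η X Z), U⟫ - ⟪D X Y Z, U⟫) :
    ∀ X Y Z U : V, Rb (J X) (J Y) Z U = Rb X Y Z U := by
  intro X Y Z U
  have hη : ∀ A B C : V, η (J A) (η (J B) C) = η A (η B C) := fun A B C => by
    simp [hηQK, hηanti, hJ2]
  have hG : R (J X) (J Y) Z U = R X Y (J Z) (J U) := by
    simpa [hJ2] using hG3 X Y (J Z) (J U)
  rw [hRb, hRb, hη, hη]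
  linarith [hRD X Y Z U, hRD (J X) (J Y) Z U, hG3 X Y Z U]
end

section
/- Let η be a quasi-Kähler torsion-type tensor on V, and let S : V × V → End(V) be a bilinear map (modelling (X,Y) ↦ (∇̄_X η)(Y,·)) such that each S(X,Y) is skew-symmetric, anticommutes with J, and satisfies S(X,JY) = −J ∘ S(X,Y). Let R be a curvature-type tensor on V satisfying the first Bianchi identity and the relation R(X,Y,Z,U) − R(X,Y,JZ,JU) = 2⟨D(X,Y)Z, U⟩, where D(X,Y) := S(X,Y) − S(Y,X) + η_{T(X,Y)}. If R satisfies Gray's second curvature condition R(X,Y,Z,U) − R(JX,JY,Z,U) = R(JX,Y,JZ,U) + R(JX,Y,Z,JU) for all X,Y,Z,U, then S(X,Y) = S(Y,X) and S(JX,JY) = −S(X,Y) for all X,Y ∈ V. (Pointwise algebraic form of Proposition 3.1.) -/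
open scoped RealInnerProductSpace

/-- Pointwise algebraic form of Proposition 3.1: for a quasi-Kähler torsion-type tensor `η`
and `S` modelling `(X,Y) ↦ (∇̄_X η)(Y,·)`, Gray's second curvature condition forces
`S(X,Y) = S(Y,X)` and `S(JX,JY) = −S(X,Y)`. -/
theorem stmt_3
    {V : Type*} [NormedAddCommGroup V] [InnerProductSpace ℝ V] [FiniteDimensional ℝ V]
    (J : V →ₗ[ℝ] V)
    (hJiso : ∀ x y : V, ⟪J x, J y⟫ = ⟪x, y⟫)
    (hJ2 : ∀ x : V, J (J x) = -x)
    -- η is a quasi-Kähler torsion-type tensor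
    (η : V →ₗ[ℝ] (V →ₗ[ℝ] V))
    (hηskew : ∀ X x y : V, ⟪η X x, y⟫ = -⟪x, η X y⟫)
    (hηanti : ∀ X x : V, η X (J x) = - J (η X x))
    (hηQK : ∀ X x : V, η (J X) x = - J (η X x))
    -- S is bilinear with skew-symmetric, J-anticommuting values and S(X,JY) = −J∘S(X,Y)
    (S : V →ₗ[ℝ] V →ₗ[ℝ] (V →ₗ[ℝ] V))
    (hSskew : ∀ X Y x y : V, ⟪S X Y x, y⟫ = -⟪x, S X Y y⟫)
    (hSanti : ∀ X Y x : V, S X Y (J x) = - J (S X Y x))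
    (hSJ : ∀ X Y x : V, S X (J Y) x = - J (S X Y x))
    -- R is a curvature-type tensor satisfying the first Bianchi identity
    (R : V →ₗ[ℝ] V →ₗ[ℝ] V →ₗ[ℝ] V →ₗ[ℝ] ℝ)
    (hR1 : ∀ X Y Z U : V, R X Y Z U = - R Y X Z U)
    (hR2 : ∀ X Y Z U : V, R X Y Z U = - R X Y U Z)
    (hR3 : ∀ X Y Z U : V, R X Y Z U = R Z U X Y)
    (hBianchi : ∀ X Y Z U : V, R X Y Z U + R Y Z X U + R Z X Y U = 0)
    -- relation between R and D(X,Y) = S(X,Y) − S(Y,X) + η_{T(X,Y)}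
    (hRD : ∀ X Y Z U : V, R X Y Z U - R X Y (J Z) (J U) =
      2 * ⟪(S X Y - S Y X + η (η X Y - η Y X)) Z, U⟫)
    -- Gray's second curvature condition
    (hG2 : ∀ X Y Z U : V, R X Y Z U - R (J X) (J Y) Z U =
      R (J X) Y (J Z) U + R (J X) Y Z (J U)) :
    (∀ X Y : V, S X Y = S Y X) ∧ (∀ X Y : V, S (J X) (J Y) = - S X Y) := by
  have hadj : ∀ x y : V, ⟪x, J y⟫ = -⟪J x, y⟫ := fun x y => by
    rw [← hJiso x (J y), hJ2, inner_neg_right]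
  have hSJ' : ∀ X Y : V, S X (J Y) = -(J ∘ₗ S X Y) := fun X Y => by
    ext x; simp [hSJ]
  have hηJ : ∀ X : V, η (J X) = -(J ∘ₗ η X) := fun X => by
    ext x; simp [hηQK]
  have hRneg : ∀ X Y Z U : V, R (-X) Y Z U = -R X Y Z U := fun X Y Z U => by
    rw [hR1, hR1 X, map_neg, LinearMap.neg_apply, LinearMap.neg_apply]
  have key : ∀ X Y Z U : V,
      ⟪S X Y Z, U⟫ = ⟪S Y X Z, U⟫ ∧ ⟪S (J X) Y Z, U⟫ = -⟪J (S X Y Z), U⟫ := by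
    intro X Y Z U
    have hD := fun A B => And.intro (And.intro (hRD A B Z U) (hRD A B (J Z) U))
      (hRD A B Z (J U))
    have hG := fun A B => And.intro (And.intro (hG2 A B Z U) (hG2 A B (J Z) U))
      (And.intro (hG2 A B Z (J U)) (hG2 A B (J Z) (J U)))
    have d₁ := hD X Y
    have d₂ := hD (J X) Y
    have d₃ := hD X (J Y)
    have d₄ := hD (J X) (J Y)
    have g₁ := hG X Y
    have g₂ := hG (J X) Y
    have g₃ := hG X (J Y)
    clear hD hG hRD hG2 hR1 hR2 hR3 hBianchi
    simp only [hSJ', hηJ, hJ2, hηanti, hSanti, hRneg, map_neg, map_add, map_sub, LinearMap.add_apply,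
      LinearMap.sub_apply, LinearMap.neg_apply, LinearMap.comp_apply, inner_add_left,
      inner_sub_left, inner_neg_left, hadj, neg_neg] at d₁ d₂ d₃ d₄ g₁ g₂ g₃
    casesm* _ ∧ _
    constructor <;> linarith
  have hsymm : ∀ X Y : V, S X Y = S Y X := fun X Y =>
    LinearMap.ext fun Z => ext_inner_right ℝ fun U => (key X Y Z U).1
  refine ⟨hsymm, fun X Y => LinearMap.ext fun Z => ext_inner_right ℝ fun U => ?_⟩
  rw [(key X (J Y) Z U).2, hSJ, map_neg, hJ2, neg_neg, LinearMap.neg_apply, inner_neg_left]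
end

section
/- Let η be a quasi-Kähler torsion-type tensor on V, let S : V × V → End(V) be bilinear with each S(X,Y) skew-symmetric, anticommuting with J and satisfying S(X,JY) = −J ∘ S(X,Y), and let R be a curvature-type tensor on V satisfying the first Bianchi identity, the relation R(X,Y,Z,U) − R(X,Y,JZ,JU) = 2⟨D(X,Y)Z, U⟩ with D(X,Y) := S(X,Y) − S(Y,X) + η_{T(X,Y)}, and Gray's second curvature condition R(X,Y,Z,U) − R(JX,JY,Z,U) = R(JX,Y,JZ,U) + R(JX,Y,Z,JU). Then the algebraic constraint ⟨η_{T(X,Y)}U, W⟩ = ⟨η_{T(U,W)}X, Y⟩ holds for all X,Y,U,W ∈ V. (Pointwise algebraic form of Remark 3.1.) -/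
open scoped RealInnerProductSpace

/-- Pointwise algebraic form of Remark 3.1: under the hypotheses of Proposition 3.1 the
algebraic constraint `⟨η_{T(X,Y)}U, W⟩ = ⟨η_{T(U,W)}X, Y⟩` holds.
-/
theorem stmt_4
    {V : Type*} [NormedAddCommGroup V] [InnerProductSpace ℝ V] [FiniteDimensional ℝ V]
    (J : V →ₗ[ℝ] V)
    (hJiso : ∀ x y : V, ⟪J x, J y⟫ = ⟪x, y⟫)
    (hJ2 : ∀ x : V, J (J x) = -x)
    -- η is a quasi-Kähler torsion-type tensor
    (η : V →ₗ[ℝ] (V →ₗ[ℝ] V))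
    (hηskew : ∀ X x y : V, ⟪η X x, y⟫ = -⟪x, η X y⟫)
    (hηanti : ∀ X x : V, η X (J x) = - J (η X x))
    (hηQK : ∀ X x : V, η (J X) x = - J (η X x))
    -- S is bilinear with skew-symmetric, J-anticommuting values and S(X,JY) = −J∘S(X,Y)
    (S : V →ₗ[ℝ] V →ₗ[ℝ] (V →ₗ[ℝ] V))
    (hSskew : ∀ X Y x y : V, ⟪S X Y x, y⟫ = -⟪x, S X Y y⟫)
    (hSanti : ∀ X Y x : V, S X Y (J x) = - J (S X Y x))
    (hSJ : ∀ X Y x : V, S X (J Y) x = - J (S X Y x))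
    -- R is a curvature-type tensor satisfying the first Bianchi identity
    (R : V →ₗ[ℝ] V →ₗ[ℝ] V →ₗ[ℝ] V →ₗ[ℝ] ℝ)
    (hR1 : ∀ X Y Z U : V, R X Y Z U = - R Y X Z U)
    (hR2 : ∀ X Y Z U : V, R X Y Z U = - R X Y U Z)
    (hR3 : ∀ X Y Z U : V, R X Y Z U = R Z U X Y)
    (hBianchi : ∀ X Y Z U : V, R X Y Z U + R Y Z X U + R Z X Y U = 0)
    -- relation between R and D(X,Y) = S(X,Y) − S(Y,X) + η_{T(X,Y)}
    (hRD : ∀ X Y Z U : V, R X Y Z U - R X Y (J Z) (J U) =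
      2 * ⟪(S X Y - S Y X + η (η X Y - η Y X)) Z, U⟫)
    -- Gray's second curvature condition
    (hG2 : ∀ X Y Z U : V, R X Y Z U - R (J X) (J Y) Z U =
      R (J X) Y (J Z) U + R (J X) Y Z (J U)) :
    ∀ X Y U W : V, ⟪η (η X Y - η Y X) U, W⟫ = ⟪η (η U W - η W U) X, Y⟫ := by
  have hJadj (x y : V) : ⟪J x, y⟫ = -⟪x, J y⟫ := by
    have h := hJiso x (J y)
    rw [hJ2, inner_neg_right] at h
    linarith
  -- the `J`-symmetries of `⟪S X Y Z, U⟫`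
  have hS (X Y Z U : V) : ⟪S X Y (J Z), U⟫ = ⟪S X (J Y) Z, U⟫ := by
    rw [hSanti, hSJ]
  -- the `J`-symmetries of `Q X Y Z U = ⟪η (T X Y) Z, U⟫`
  set Q : V → V → V → V → ℝ := fun X Y Z U => ⟪η (η X Y - η Y X) Z, U⟫ with hQ
  have hQ₁ (X Y Z U : V) : Q (J X) Y (J Z) U = Q X Y Z U := by
    simp [hQ, hηQK, hηanti, hJ2, inner_sub_left]
  have hQ₂ (X Y Z U : V) : Q X (J Y) (J Z) U = Q X Y Z U := by
    simp [hQ, hηQK, hηanti, hJ2]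
  have hQ₃ (X Y Z U : V) : Q (J X) (J Y) Z U = -Q X Y Z U := by
    simp [hQ, hηQK, hηanti, hJ2, inner_sub_left, inner_neg_left]
    ring
  have hQ₄ (X Y Z U : V) : Q X Y (J Z) (J U) = -Q X Y Z U := by
    simp [hQ, hηanti, hJiso, inner_sub_left, inner_neg_left]
    ring
  set D : V → V → V → V → ℝ :=
    fun X Y Z U => ⟪(S X Y - S Y X + η (η X Y - η Y X)) Z, U⟫ with hD
  have hD_eq (X Y Z U : V) : D X Y Z U = ⟪S X Y Z, U⟫ - ⟪S Y X Z, U⟫ + Q X Y Z U := by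
    simp only [hD, hQ, LinearMap.add_apply, LinearMap.sub_apply, inner_add_left, inner_sub_left]
  have hDJ (X Y Z U : V) : D X Y Z (J U) = D X Y (J Z) U := by
    simp only [hD, hSanti, hηanti, LinearMap.add_apply, LinearMap.sub_apply, inner_add_left,
      inner_sub_left, inner_neg_left, hJadj, neg_neg]
  -- projection of `D` onto the type in which `Q` lives
  have hproj (X Y Z U : V) :
      D X Y Z U - D (J X) (J Y) Z U + D (J X) Y (J Z) U + D X (J Y) (J Z) U = 4 * Q X Y Z U := by
    simp only [hD_eq, hS, hQ₁, hQ₂, hQ₃, hJ2, map_neg, LinearMap.neg_apply, inner_neg_left]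
    ring
  -- the second curvature condition in terms of `D`
  have hsymm (X Y Z U : V) : D Z U X Y = D (J X) Y (J Z) U := by
    have h₁ := hRD Z U X Y
    have h₂ := hRD (J X) Y Z (J U)
    have h₃ := hG2 X Y Z U
    rw [hJ2, map_neg] at h₂
    rw [hR3 Z U X Y, hR3 Z U (J X) (J Y)] at h₁
    have h₄ := hDJ (J X) Y Z U
    simp only [hD] at h₄ ⊢
    linarith
  have hneg (X Y Z U : V) : D (-X) Y Z U = -D X Y Z U := by
    simp [hD, inner_sub_left, inner_add_left, inner_neg_left]
    ring
  have hneg' (X Y Z U : V) : D X Y (-Z) U = -D X Y Z U := by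
    simp only [hD, map_neg, inner_neg_left]
  have hhalf (X Y Z U : V) : 2 * Q Z U X Y = D (J X) Y (J Z) U + D X Y Z U := by
    have h := hproj Z U X Y
    rw [hsymm X Y Z U, hsymm X Y (J Z) (J U), hsymm (J X) Y (J Z) U, hsymm (J X) Y Z (J U)] at h
    simp only [hDJ, hJ2, map_neg, hneg, hneg'] at h
    linarith
  intro X Y U W
  change Q X Y U W = Q U W X Y
  have h₁ := hhalf X Y U W
  have h₂ := hhalf (J X) (J Y) U W
  rw [hQ₄, hJ2, hneg] at h₂
  linarith [hproj X Y U W]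
end

section
/- Let η be a quasi-Kähler torsion-type tensor on V with torsion T, and let P : V × V → End(V) be a bilinear map (modelling (A,Z) ↦ (∇̄_A η)(Z,·)) satisfying P(JX,JY) = −P(X,Y) for all X,Y ∈ V. If the cyclic sum P(T(X,Y),Z) + P(T(Y,Z),X) + P(T(Z,X),Y) = 0 holds for all X,Y,Z ∈ V, then each summand vanishes: P(T(X,Y),Z) = 0 for all X,Y,Z ∈ V. (Pointwise algebraic form of the final step of Proposition 3.2, which yields ∇̄_{T(X,Y)}η = 0.) -/
open scoped RealInnerProductSpace

/-- Pointwise algebraic form of the final step of Proposition 3.2: if the bilinear map `P`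
(modelling `(A,Z) ↦ (∇̄_A η)(Z,·)`) satisfies `P(JX,JY) = −P(X,Y)` and the cyclic sum
`P(T(X,Y),Z) + P(T(Y,Z),X) + P(T(Z,X),Y)` vanishes, then each summand vanishes. -/
theorem stmt_5
    {V : Type*} [NormedAddCommGroup V] [InnerProductSpace ℝ V] [FiniteDimensional ℝ V]
    (J : V →ₗ[ℝ] V)
    (hJiso : ∀ x y : V, ⟪J x, J y⟫ = ⟪x, y⟫)
    (hJ2 : ∀ x : V, J (J x) = -x)
    -- η is a quasi-Kähler torsion-type tensor, with torsion T(X,Y) = η X Y - η Y X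
    (η : V →ₗ[ℝ] (V →ₗ[ℝ] V))
    (hηskew : ∀ X x y : V, ⟪η X x, y⟫ = -⟪x, η X y⟫)
    (hηanti : ∀ X x : V, η X (J x) = - J (η X x))
    (hηQK : ∀ X x : V, η (J X) x = - J (η X x))
    -- P is bilinear with P(JX,JY) = −P(X,Y)
    (P : V →ₗ[ℝ] V →ₗ[ℝ] (V →ₗ[ℝ] V))
    (hPJ : ∀ X Y : V, P (J X) (J Y) = - P X Y)
    -- the cyclic sum vanishes
    (hcyc : ∀ X Y Z : V,
      P (η X Y - η Y X) Z + P (η Y Z - η Z Y) X + P (η Z X - η X Z) Y = 0) :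
    ∀ X Y Z : V, P (η X Y - η Y X) Z = 0 := by
  have hT₁ : ∀ X Y, η (J X) Y - η Y (J X) = -J (η X Y - η Y X) := fun X Y => by
    rw [hηQK, hηanti, map_sub]; abel
  have hT₂ : ∀ X Y, η X (J Y) - η (J Y) X = -J (η X Y - η Y X) := fun X Y => by
    rw [hηQK, hηanti, map_sub]; abel
  have hP : ∀ X Y, P X (J Y) = P (J X) Y := fun X Y => by
    have h := hPJ X (J Y)
    rw [hJ2, map_neg, neg_inj] at h
    exact h.symm
  have hJT : ∀ X Y Z, P (J (η X Y - η Y X)) Z = 0 := fun X Y Z => by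
    have h₁ := hcyc (J X) Y Z
    have h₂ := hcyc X (J Y) Z
    rw [hT₁, hT₂, hP] at h₁ h₂
    simp only [map_neg, LinearMap.neg_apply] at h₁ h₂
    have h : (2 : ℝ) • P (J (η X Y - η Y X)) Z = 0 := by
      linear_combination (norm := module) -h₁ - h₂
    exact (smul_eq_zero.mp h).resolve_left two_ne_zero
  intro X Y Z
  have h := hJT (J X) Y Z
  rwa [hT₁, map_neg, hJ2, neg_neg] at h
end

section
/- Let η be a torsion-type tensor on V with torsion T, and let R̄ : V × V → End(V) be a bilinear map (modelling the curvature operator of the canonical Hermitian connection with parallel torsion) satisfying, for all A,B,C ∈ V: (a) the cyclic identity [R̄(A,B), η_C] + [R̄(B,C), η_A] + [R̄(C,A), η_B] = η_{R̄(A,B)C} + η_{R̄(B,C)A} + η_{R̄(C,A)B}, and (b) the first Bianchi identity with parallel torsion R̄(A,B)C + R̄(B,C)A + R̄(C,A)B = −(T(T(A,B),C) + T(T(B,C),A) + T(T(C,A),B)). Then for all X,Y ∈ V with η_X = 0 and η_Y = 0 and every V' ∈ V one has [R̄(X,Y), η_{V'}] = η_{β_{V'}(X,Y)}, where β_{V'}(X,Y)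 = η_{η_{V'}Y}X − η_{η_{V'}X}Y. (Pointwise algebraic form of Lemma 4.2(ii).) -/
open scoped RealInnerProductSpace

/-- Pointwise algebraic form of Lemma 4.2(ii): for the curvature operator `R̄` of the canonical
Hermitian connection (with parallel torsion), and `X, Y` in the Kähler nullity,
`[R̄(X,Y), η_{V'}] = η_{β_{V'}(X,Y)}` where `β_{V'}(X,Y) = η_{η_{V'}Y}X − η_{η_{V'}X}Y`. -/
theorem stmt_6
    {V : Type*} [NormedAddCommGroup V] [InnerProductSpace ℝ V] [FiniteDimensional ℝ V]
    (J : V →ₗ[ℝ] V)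
    (hJiso : ∀ x y : V, ⟪J x, J y⟫ = ⟪x, y⟫)
    (hJ2 : ∀ x : V, J (J x) = -x)
    -- η is a torsion-type tensor, with torsion T(X,Y) = η X Y - η Y X
    (η : V →ₗ[ℝ] (V →ₗ[ℝ] V))
    (hηskew : ∀ X x y : V, ⟪η X x, y⟫ = -⟪x, η X y⟫)
    (hηanti : ∀ X x : V, η X (J x) = - J (η X x))
    -- R̄ is a bilinear map into endomorphisms
    (Rb : V →ₗ[ℝ] V →ₗ[ℝ] (V →ₗ[ℝ] V))
    -- (a) the cyclic identity
    (ha : ∀ A B C : V,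
      (Rb A B ∘ₗ η C - η C ∘ₗ Rb A B) + (Rb B C ∘ₗ η A - η A ∘ₗ Rb B C)
        + (Rb C A ∘ₗ η B - η B ∘ₗ Rb C A)
      = η (Rb A B C) + η (Rb B C A) + η (Rb C A B))
    -- (b) the first Bianchi identity with parallel torsion
    (hb : ∀ A B C : V,
      Rb A B C + Rb B C A + Rb C A B =
      -((η (η A B - η B A) C - η C (η A B - η B A))
        + (η (η B C - η C B) A - η A (η B C - η C B))
        + (η (η C A - η A C) B - η B (η C A - η A C)))) :
    ∀ X Y V' : V, η X = 0 → η Y = 0 →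
      Rb X Y ∘ₗ η V' - η V' ∘ₗ Rb X Y = η (η (η V' Y) X - η (η V' X) Y) := by
  intro X Y Z hX hY
  have h := ha X Y Z
  rw [← map_add, ← map_add, hb X Y Z] at h
  simp only [hX, hY, LinearMap.zero_apply, LinearMap.comp_zero, LinearMap.zero_comp, sub_zero,
    zero_sub, map_zero, map_neg, LinearMap.neg_apply, add_zero, zero_add] at h
  rw [h, ← map_neg]
  congr 1
  abel
end

section
/- Let η be an almost Kähler (hence quasi-Kähler) torsion-type tensor on V with torsion T, Kähler nullity H and 𝒱 = H⊥. Let D₁, D₂ be orthogonal subspaces of 𝒱 with 𝒱 = D₁ ⊕ D₂, both invariant under J. Let R̄ : V×V×V×V → ℝ be a quadrilinear map such that R̄(Ja,Jb,c,d) = R̄(a,b,c,d) for all a,b,c,d, such that R̄(a,b,x₁,x₂) = 0 whenever a,b ∈ 𝒱, x₁ ∈ D₁, x₂ ∈ D₂ (the consequence of D₁,D₂ being ∇̄-parallel inside 𝒱), and such that the first Bianchi identity with torsion holds: R̄(A,B,C,U) + R̄(B,C,A,U) + R̄(C,A,B,U) + ⟨T(A,B), η_U C⟩ + ⟨T(B,C),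 η_U A⟩ + ⟨T(C,A), η_U B⟩ = 0 for all A,B,C,U ∈ V. Then for all v₁,w₁ ∈ D₁, w₂ ∈ D₂ and w ∈ 𝒱: (i) R̄(v₁,w₁,w,w₂) = −⟨T(w₁,w), η_{w₂}v₁⟩ − ⟨T(w,v₁), η_{w₂}w₁⟩, and (ii) ⟨T(v₁,w₁), η_{w₂}w⟩ = 0, i.e. the 𝒱-component of η_{w₂}T(v₁,w₁) vanishes. (Pointwise algebraic form of Lemma 4.4(i) and (ii).) -/
open scoped RealInnerProductSpace

/-- Pointwise algebraic form of Lemma 4.4(i) and (ii): for an almost Kähler torsion-type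
tensor `η` with Kähler nullity `H = ker η` and `𝒱 = Hᗮ`, and an orthogonal `J`-invariant
decomposition `𝒱 = D₁ ⊕ D₂`, the stated curvature hypotheses give
`R̄(v₁,w₁,w,w₂) = −⟨T(w₁,w), η_{w₂}v₁⟩ − ⟨T(w,v₁), η_{w₂}w₁⟩` and
`⟨T(v₁,w₁), η_{w₂}w⟩ = 0`. -/
theorem stmt_7
    {V : Type*} [NormedAddCommGroup V] [InnerProductSpace ℝ V] [FiniteDimensional ℝ V]
    (J : V →ₗ[ℝ] V)
    (hJiso : ∀ x y : V, ⟪J x, J y⟫ = ⟪x, y⟫)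
    (hJ2 : ∀ x : V, J (J x) = -x)
    -- η is an almost Kähler (hence quasi-Kähler) torsion-type tensor
    (η : V →ₗ[ℝ] (V →ₗ[ℝ] V))
    (hηskew : ∀ X x y : V, ⟪η X x, y⟫ = -⟪x, η X y⟫)
    (hηanti : ∀ X x : V, η X (J x) = - J (η X x))
    (hηQK : ∀ X x : V, η (J X) x = - J (η X x))
    (hAK : ∀ X Y Z : V, ⟪η X Y - η Y X, Z⟫ = -⟪η Z X, Y⟫)
    -- D₁, D₂ : orthogonal J-invariant subspaces with 𝒱 = D₁ ⊕ D₂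
    (D₁ D₂ : Submodule ℝ V)
    (hD₁V : D₁ ≤ (LinearMap.ker η)ᗮ) (hD₂V : D₂ ≤ (LinearMap.ker η)ᗮ)
    (horth : ∀ x ∈ D₁, ∀ y ∈ D₂, ⟪x, y⟫ = 0)
    (hsum : D₁ ⊔ D₂ = (LinearMap.ker η)ᗮ)
    (hJD₁ : ∀ x ∈ D₁, J x ∈ D₁) (hJD₂ : ∀ x ∈ D₂, J x ∈ D₂)
    -- R̄ is a quadrilinear map with the stated properties
    (Rb : V →ₗ[ℝ] V →ₗ[ℝ] V →ₗ[ℝ] V →ₗ[ℝ] ℝ)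
    (hRbJ : ∀ a b c d : V, Rb (J a) (J b) c d = Rb a b c d)
    (hRb0 : ∀ a ∈ (LinearMap.ker η)ᗮ, ∀ b ∈ (LinearMap.ker η)ᗮ,
      ∀ x₁ ∈ D₁, ∀ x₂ ∈ D₂, Rb a b x₁ x₂ = 0)
    -- first Bianchi identity with torsion
    (hBianchi : ∀ A B C U : V,
      Rb A B C U + Rb B C A U + Rb C A B U
        + ⟪η A B - η B A, η U C⟫ + ⟪η B C - η C B, η U A⟫ + ⟪η C A - η A C, η U B⟫ = 0) :
    ∀ v₁ ∈ D₁, ∀ w₁ ∈ D₁, ∀ w₂ ∈ D₂, ∀ w ∈ (LinearMap.ker η)ᗮ,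
      (Rb v₁ w₁ w w₂ = -⟪η w₁ w - η w w₁, η w₂ v₁⟫ - ⟪η w v₁ - η v₁ w, η w₂ w₁⟫) ∧
      ⟪η v₁ w₁ - η w₁ v₁, η w₂ w⟫ = 0 := by
  intro v₁ hv₁ w₁ hw₁ w₂ hw₂ w hw
  have hB := hBianchi v₁ w₁ w w₂
  have hBJ := hBianchi (J v₁) (J w₁) w w₂
  rw [hRb0 w₁ (hD₁V hw₁) w hw v₁ hv₁ w₂ hw₂, hRb0 w hw v₁ (hD₁V hv₁) w₁ hw₁ w₂ hw₂] at hB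
  rw [hRbJ, hRb0 (J w₁) (hD₁V (hJD₁ w₁ hw₁)) w hw (J v₁) (hJD₁ v₁ hv₁) w₂ hw₂,
    hRb0 w hw (J v₁) (hD₁V (hJD₁ v₁ hv₁)) (J w₁) (hJD₁ w₁ hw₁) w₂ hw₂] at hBJ
  -- The torsion is `J`-antilinear in each argument.
  have hTJJ : η (J v₁) (J w₁) - η (J w₁) (J v₁) = -(η v₁ w₁ - η w₁ v₁) := by
    simp only [hηQK, hηanti, map_neg, hJ2]
    abel
  have hTJ_left : η (J w₁) w - η w (J w₁) = -J (η w₁ w - η w w₁) := by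
    simp only [hηQK, hηanti, map_sub]
    abel
  have hTJ_right : η w (J v₁) - η (J v₁) w = -J (η w v₁ - η v₁ w) := by
    simp only [hηQK, hηanti, map_sub]
    abel
  rw [hTJJ, hTJ_left, hTJ_right, hηanti w₂ v₁, hηanti w₂ w₁, inner_neg_neg, inner_neg_neg,
    hJiso, hJiso, inner_neg_left] at hBJ
  constructor <;> linarith
end

section
/- Let η be an almost Kähler and quasi-Kähler torsion-type tensor on V with torsion T, Kähler nullity H and 𝒱 = H⊥. Let R̄ : V×V×V×V → ℝ be quadrilinear with R̄(A,B,C,D) = −R̄(B,A,C,D) = −R̄(A,B,D,C) and R̄(JA,JB,C,D) = R̄(A,B,C,D) for all A,B,C,D, and satisfying R̄(Y,V₁,V₂,V₃) = −⟨[η_{V₂},η_{V₃}]Y, V₁⟩ for Y ∈ H, V₁,V₂,V₃ ∈ 𝒱. Let F : V×V×V×V×V → ℝ be multilinear (modelling (∇̄_X R̄)) with F(X,JV₁,JV₂,V₃,V₄) = F(X,V₁,V₂,V₃,V₄), and assume the second Bianchi identity in the reduced form F(X,V₁,V₂,V₃,V₄) + R̄(T(X,V₁),V₂,V₃,V₄)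 + R̄(T(V₁,V₂),X,V₃,V₄) + R̄(T(V₂,X),V₁,V₃,V₄) = 0 for all X ∈ H, V₁,...,V₄ ∈ 𝒱. Then for all X ∈ H and V₁,...,V₄ ∈ 𝒱: (i) R̄(η_{V₂}X, V₁, V₃, V₄) − R̄(η_{V₁}X, V₂, V₃, V₄) = −⟨[η_{V₃},η_{V₄}]X, T(V₁,V₂)⟩, and (ii) F(X,V₁,V₂,V₃,V₄) = 0. (Pointwise algebraic form of Proposition 5.1.) -/
open scoped RealInnerProductSpace

/-- Pointwise algebraic form of Proposition 5.1: for `X ∈ H` and `V₁,...,V₄ ∈ 𝒱`,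
(i) `R̄(η_{V₂}X, V₁, V₃, V₄) − R̄(η_{V₁}X, V₂, V₃, V₄) = −⟨[η_{V₃},η_{V₄}]X, T(V₁,V₂)⟩` and
(ii) `(∇̄_X R̄)(V₁,V₂,V₃,V₄) = 0`. -/
theorem stmt_11
    {V : Type*} [NormedAddCommGroup V] [InnerProductSpace ℝ V] [FiniteDimensional ℝ V]
    (J : V →ₗ[ℝ] V)
    (hJiso : ∀ x y : V, ⟪J x, J y⟫ = ⟪x, y⟫)
    (hJ2 : ∀ x : V, J (J x) = -x)
    -- η is an almost Kähler and quasi-Kähler torsion-type tensor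
    (η : V →ₗ[ℝ] (V →ₗ[ℝ] V))
    (hηskew : ∀ X x y : V, ⟪η X x, y⟫ = -⟪x, η X y⟫)
    (hηanti : ∀ X x : V, η X (J x) = - J (η X x))
    (hηQK : ∀ X x : V, η (J X) x = - J (η X x))
    (hAK : ∀ X Y Z : V, ⟪η X Y - η Y X, Z⟫ = -⟪η Z X, Y⟫)
    -- R̄ is a quadrilinear map with the stated symmetries
    (Rb : V →ₗ[ℝ] V →ₗ[ℝ] V →ₗ[ℝ] V →ₗ[ℝ] ℝ)
    (hRb1 : ∀ A B C D : V, Rb A B C D = - Rb B A C D)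
    (hRb2 : ∀ A B C D : V, Rb A B C D = - Rb A B D C)
    (hRbJ : ∀ A B C D : V, Rb (J A) (J B) C D = Rb A B C D)
    (hRbH : ∀ Y ∈ LinearMap.ker η, ∀ V₁ ∈ (LinearMap.ker η)ᗮ, ∀ V₂ ∈ (LinearMap.ker η)ᗮ,
      ∀ V₃ ∈ (LinearMap.ker η)ᗮ,
      Rb Y V₁ V₂ V₃ = -⟪η V₂ (η V₃ Y) - η V₃ (η V₂ Y), V₁⟫)
    -- F models (∇̄_X R̄)
    (F : V →ₗ[ℝ] V →ₗ[ℝ] V →ₗ[ℝ] V →ₗ[ℝ] V →ₗ[ℝ] ℝ)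
    (hFJ : ∀ X V₁ V₂ V₃ V₄ : V, F X (J V₁) (J V₂) V₃ V₄ = F X V₁ V₂ V₃ V₄)
    -- second Bianchi identity in reduced form
    (hBianchi2 : ∀ X ∈ LinearMap.ker η, ∀ V₁ ∈ (LinearMap.ker η)ᗮ,
      ∀ V₂ ∈ (LinearMap.ker η)ᗮ, ∀ V₃ ∈ (LinearMap.ker η)ᗮ, ∀ V₄ ∈ (LinearMap.ker η)ᗮ,
      F X V₁ V₂ V₃ V₄ + Rb (η X V₁ - η V₁ X) V₂ V₃ V₄
        + Rb (η V₁ V₂ - η V₂ V₁) X V₃ V₄ + Rb (η V₂ X - η X V₂) V₁ V₃ V₄ = 0) :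
    ∀ X ∈ LinearMap.ker η, ∀ V₁ ∈ (LinearMap.ker η)ᗮ, ∀ V₂ ∈ (LinearMap.ker η)ᗮ,
      ∀ V₃ ∈ (LinearMap.ker η)ᗮ, ∀ V₄ ∈ (LinearMap.ker η)ᗮ,
      (Rb (η V₂ X) V₁ V₃ V₄ - Rb (η V₁ X) V₂ V₃ V₄ =
        -⟪η V₃ (η V₄ X) - η V₄ (η V₃ X), η V₁ V₂ - η V₂ V₁⟫) ∧
      F X V₁ V₂ V₃ V₄ = 0 := by
  intro X hX V₁ h₁ V₂ h₂ V₃ h₃ V₄ h₄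
  have hX0 : η X = 0 := LinearMap.mem_ker.mp hX
  have hJ𝒱 : ∀ v ∈ (LinearMap.ker η)ᗮ, J v ∈ (LinearMap.ker η)ᗮ := by
    intro v hv
    rw [Submodule.mem_orthogonal] at hv ⊢
    intro u hu
    have hJu : J u ∈ LinearMap.ker η := by
      rw [LinearMap.mem_ker] at hu ⊢
      ext x
      simp [hηQK, hu]
    rw [← hJiso u (J v), hJ2, inner_neg_right, hv _ hJu, neg_zero]
  have hT𝒱 : η V₁ V₂ - η V₂ V₁ ∈ (LinearMap.ker η)ᗮ := by
    rw [Submodule.mem_orthogonal']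
    intro u hu
    rw [hAK, LinearMap.mem_ker.mp hu]
    simp
  have hTX : Rb (η V₁ V₂ - η V₂ V₁) X V₃ V₄ =
      ⟪η V₃ (η V₄ X) - η V₄ (η V₃ X), η V₁ V₂ - η V₂ V₁⟫ := by
    rw [hRb1, hRbH X hX _ hT𝒱 V₃ h₃ V₄ h₄, neg_neg]
  have hTJ : η (J V₁) (J V₂) - η (J V₂) (J V₁) = -(η V₁ V₂ - η V₂ V₁) := by
    simp only [hηQK, hηanti, map_neg, hJ2]
    abel
  have hRneg : ∀ A B C D : V, Rb (-A) B C D = -Rb A B C D := by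
    intro A B C D
    rw [← neg_one_smul ℝ A, LinearMap.map_smul]
    simp only [LinearMap.smul_apply, smul_eq_mul, neg_one_mul]
  have hB := hBianchi2 X hX V₁ h₁ V₂ h₂ V₃ h₃ V₄ h₄
  have hBJ := hBianchi2 X hX (J V₁) (hJ𝒱 V₁ h₁) (J V₂) (hJ𝒱 V₂ h₂) V₃ h₃ V₄ h₄
  rw [hTJ] at hBJ
  simp only [hX0, LinearMap.zero_apply, zero_sub, sub_zero, hFJ, hηQK, neg_neg, hRbJ] at hB hBJ
  rw [hTX] at hB
  rw [hRneg, hTX, hRneg, hRbJ] at hBJ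
  rw [hRneg] at hB
  constructor <;> linarith
end

section
/- Let η be an almost Kähler torsion-type tensor on V with Kähler nullity H, 𝒱 = H⊥, projected tensor η̂, 𝒱₀ = span{T(v,w) : v,w ∈ 𝒱}, and 𝒱₁ the orthogonal complement of 𝒱₀ in 𝒱. Assume η_V X ∈ 𝒱₁ for all V ∈ 𝒱₁ and X ∈ H, and for X ∈ H let γ_X : 𝒱₁ → 𝒱₁ be the map V ↦ η_V X. Let R̄ : V × V → End(V) be bilinear with each R̄(A,B) skew-symmetric, write R̄(A,B,C,D) = ⟨R̄(A,B)C, D⟩, and assume: (a) the symmetry relation R̄(A,B,C,D) − R̄(C,D,A,B) = ⟨[η_A,η_B]C,D⟩ − ⟨[η_C,η_D]A,B⟩ for all A,B,C,D ∈ V, and (b) [R̄(X,Y), η_V] = η_{[γ_X,γ_Y]V} for all X,Y ∈ H and V ∈ 𝒱₁. Then for all X,Y,Z ∈ H and V,W ∈ 𝒱₁: R̄(X,Y,η_V W, Z) = R̄(γ_Z V, W, X, Y) + ⟨[[γ_X,γ_Y],γ_Z]V, W⟩. (Pointwise algebraic form of Lemma 5.5.) -/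
open scoped RealInnerProductSpace

/-- For `X` in the Kähler nullity, the operator `v ↦ η v X` is symmetric. -/
theorem almostKahler_flip_symmetric
    {V : Type*} [NormedAddCommGroup V] [InnerProductSpace ℝ V]
    (η : V →ₗ[ℝ] (V →ₗ[ℝ] V))
    (hηskew : ∀ X x y : V, ⟪η X x, y⟫ = -⟪x, η X y⟫)
    (hAK : ∀ X Y Z : V, ⟪η X Y - η Y X, Z⟫ = -⟪η Z X, Y⟫)
    {X : V} (hX : η X = 0) (a b : V) : ⟪η a X, b⟫ = ⟪a, η b X⟫ := by
  simpa [hX, hηskew b a X] using hAK a X b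

/-- Pointwise algebraic form of Lemma 5.5: for `X,Y,Z ∈ H` and `V,W ∈ 𝒱₁`,
`R̄(X,Y,η_V W, Z) = R̄(γ_Z V, W, X, Y) + ⟨[[γ_X,γ_Y],γ_Z]V, W⟩`,
where `γ_X V = η_V X` (that is, `γ_X = η.flip X`). -/
theorem stmt_14
    {V : Type*} [NormedAddCommGroup V] [InnerProductSpace ℝ V] [FiniteDimensional ℝ V]
    (J : V →ₗ[ℝ] V)
    (hJiso : ∀ x y : V, ⟪J x, J y⟫ = ⟪x, y⟫)
    (hJ2 : ∀ x : V, J (J x) = -x)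
    -- η is an almost Kähler torsion-type tensor
    (η : V →ₗ[ℝ] (V →ₗ[ℝ] V))
    (hηskew : ∀ X x y : V, ⟪η X x, y⟫ = -⟪x, η X y⟫)
    (hηanti : ∀ X x : V, η X (J x) = - J (η X x))
    (hAK : ∀ X Y Z : V, ⟪η X Y - η Y X, Z⟫ = -⟪η Z X, Y⟫)
    -- the subspaces 𝒱, 𝒱₀, 𝒱₁
    (𝒱 : Submodule ℝ V) (h𝒱 : 𝒱 = (LinearMap.ker η)ᗮ)
    (𝒱₀ : Submodule ℝ V)
    (h𝒱₀ : 𝒱₀ = Submodule.span ℝ {x : V | ∃ v ∈ 𝒱, ∃ w ∈ 𝒱, x = η v w - η w v})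
    (𝒱₁ : Submodule ℝ V) (h𝒱₁ : 𝒱₁ = 𝒱 ⊓ 𝒱₀ᗮ)
    -- γ_X maps 𝒱₁ to 𝒱₁ for X ∈ H
    (hγ : ∀ Vv ∈ 𝒱₁, ∀ X ∈ LinearMap.ker η, η Vv X ∈ 𝒱₁)
    -- R̄ is bilinear with skew-symmetric values
    (Rb : V →ₗ[ℝ] V →ₗ[ℝ] (V →ₗ[ℝ] V))
    (hRbskew : ∀ A B x y : V, ⟪Rb A B x, y⟫ = -⟪x, Rb A B y⟫)
    -- (a) the symmetry relation
    (ha : ∀ A B C D : V, ⟪Rb A B C, D⟫ - ⟪Rb C D A, B⟫ =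
      ⟪η A (η B C) - η B (η A C), D⟫ - ⟪η C (η D A) - η D (η C A), B⟫)
    -- (b) [R̄(X,Y), η_V] = η_{[γ_X,γ_Y]V} for X,Y ∈ H, V ∈ 𝒱₁
    (hb : ∀ X ∈ LinearMap.ker η, ∀ Y ∈ LinearMap.ker η, ∀ Vv ∈ 𝒱₁,
      Rb X Y ∘ₗ η Vv - η Vv ∘ₗ Rb X Y =
        η ((η.flip X ∘ₗ η.flip Y - η.flip Y ∘ₗ η.flip X) Vv)) :
    ∀ X ∈ LinearMap.ker η, ∀ Y ∈ LinearMap.ker η, ∀ Z ∈ LinearMap.ker η,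
      ∀ Vv ∈ 𝒱₁, ∀ Wv ∈ 𝒱₁,
      ⟪Rb X Y (η Vv Wv), Z⟫ = ⟪Rb (η Vv Z) Wv X, Y⟫ +
        ⟪((η.flip X ∘ₗ η.flip Y - η.flip Y ∘ₗ η.flip X) ∘ₗ η.flip Z
          - η.flip Z ∘ₗ (η.flip X ∘ₗ η.flip Y - η.flip Y ∘ₗ η.flip X)) Vv, Wv⟫ := by
  intro X hX Y hY Z hZ Vv hV Wv _
  have hX' : η X = 0 := hX
  have hY' : η Y = 0 := hY
  have hsymm := fun {X : V} (hX : η X = 0) => almostKahler_flip_symmetric η hηskew hAK hX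
  have hcomm := congrArg (fun f : V →ₗ[ℝ] V => ⟪f Wv, Z⟫) (hb X hX Y hY Vv hV)
  have hpair := ha X Y (η Vv Z) Wv
  simp only [LinearMap.sub_apply, LinearMap.comp_apply, LinearMap.flip_apply, map_sub,
    inner_sub_left, hX', hY', LinearMap.zero_apply, map_zero, inner_zero_left]
    at hcomm hpair ⊢
  have hR : ⟪η Vv (Rb X Y Wv), Z⟫ = ⟪Rb X Y (η Vv Z), Wv⟫ := by
    rw [hηskew, hRbskew, neg_neg, real_inner_comm]
  have hskewZ (U : V) : ⟪η U Wv, Z⟫ = -⟪η U Z, Wv⟫ := by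
    rw [hηskew, real_inner_comm]
  have hUW : ⟪η (η Vv Z) (η Wv X), Y⟫ = -⟪η (η (η Vv Z) Y) X, Wv⟫ := by
    rw [hηskew, real_inner_comm, hsymm hX']
  have hWU : ⟪η Wv (η (η Vv Z) X), Y⟫ = -⟪η (η (η Vv Z) X) Y, Wv⟫ := by
    rw [hηskew, hsymm hY']
  rw [hskewZ, hskewZ] at hcomm
  linarith
end

section
/- Let V be a real inner product space and J : V → V a linear isometry with J ∘ J = -id. Let A and B be symmetric endomorphisms of V that both anticommute with J. If the double commutators [[A,B],A] and [[A, J∘B],A] both vanish, then A∘B = 0 (and hence also B∘A = 0). (This is the algebraic core of Lemma 5.6, with A = γ_{X₁}, B = γ_{X₂}: it yields the orthogonality of η_{𝒱₁}H₁ and η_{𝒱₁}H₂.) -/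
open scoped RealInnerProductSpace

/-- The kernels of a symmetric endomorphism and of its square agree. -/
theorem apply_eq_zero_of_apply_apply_eq_zero
    {V : Type*} [NormedAddCommGroup V] [InnerProductSpace ℝ V] {A : V →ₗ[ℝ] V}
    (hA : ∀ x y : V, ⟪A x, y⟫ = ⟪x, A y⟫) {x : V} (hx : A (A x) = 0) : A x = 0 := by
  rw [← inner_self_eq_zero (𝕜 := ℝ), hA, hx, inner_zero_right]

/-- Algebraic core of Lemma 5.6: if `A`, `B` are symmetric endomorphisms of a real inner
product space which anticommute with `J`, and the double commutators `[[A,B],A]` and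
`[[A, J∘B],A]` both vanish, then `A∘B = 0` and `B∘A = 0`. -/
theorem stmt_15
    {V : Type*} [NormedAddCommGroup V] [InnerProductSpace ℝ V]
    (J : V →ₗ[ℝ] V)
    (hJiso : ∀ x y : V, ⟪J x, J y⟫ = ⟪x, y⟫)
    (hJ2 : ∀ x : V, J (J x) = -x)
    (A B : V →ₗ[ℝ] V)
    (hAsym : ∀ x y : V, ⟪A x, y⟫ = ⟪x, A y⟫)
    (hBsym : ∀ x y : V, ⟪B x, y⟫ = ⟪x, B y⟫)
    (hAJ : ∀ x : V, A (J x) = - J (A x))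
    (hBJ : ∀ x : V, B (J x) = - J (B x))
    (h1 : (A ∘ₗ B - B ∘ₗ A) ∘ₗ A - A ∘ₗ (A ∘ₗ B - B ∘ₗ A) = 0)
    (h2 : (A ∘ₗ (J ∘ₗ B) - (J ∘ₗ B) ∘ₗ A) ∘ₗ A - A ∘ₗ (A ∘ₗ (J ∘ₗ B) - (J ∘ₗ B) ∘ₗ A) = 0) :
    A ∘ₗ B = 0 ∧ B ∘ₗ A = 0 := by
  have hJinj : ∀ x : V, J x = 0 → x = 0 := fun x hx => by
    simpa [hx] using hJ2 x
  have e1 : ∀ x, (2 : ℝ) • A (B (A x)) = B (A (A x)) + A (A (B x)) := fun x => by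
    have h := LinearMap.congr_fun h1 x
    simp only [LinearMap.sub_apply, LinearMap.comp_apply, LinearMap.zero_apply, map_sub] at h
    rw [← sub_eq_zero, ← h]
    module
  have e2 : ∀ x, (2 : ℝ) • A (B (A x)) = -(B (A (A x)) + A (A (B x))) := fun x => by
    have h := LinearMap.congr_fun h2 x
    simp only [LinearMap.sub_apply, LinearMap.comp_apply, LinearMap.zero_apply, map_sub, hAJ,
      map_neg] at h
    rw [← sub_eq_zero]
    apply hJinj
    simp only [map_sub, map_neg, map_add, map_smul]
    rw [← neg_eq_zero, ← h]
    module
  have hanti : ∀ x, B (A (A x)) + A (A (B x)) = 0 := fun x => by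
    have h := (e1 x).symm.trans (e2 x)
    rw [eq_neg_iff_add_eq_zero, ← two_smul ℝ] at h
    exact (smul_eq_zero.mp h).resolve_left two_ne_zero
  have hABA : ∀ x, A (B (A x)) = 0 := fun x => by
    simpa [hanti x] using e1 x
  have hAB : ∀ x, A (B x) = 0 := fun x => by
    have h3 : A (A (A (B x))) = 0 := by
      simpa [hABA] using congrArg A (hanti x)
    exact apply_eq_zero_of_apply_apply_eq_zero hAsym
      (apply_eq_zero_of_apply_apply_eq_zero hAsym h3)
  refine ⟨LinearMap.ext hAB, LinearMap.ext fun x => ?_⟩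
  refine ext_inner_right ℝ fun y => ?_
  simp [hBsym, hAsym, hAB]
end

section
/- Let η be a quasi-Kähler torsion-type tensor on V with torsion T, where V has dimension 2n, and let R : V×V×V×V → ℝ be any quadrilinear map. Define R̄(X,Y,Z,U) = R(X,Y,Z,U) + ⟨[η_X,η_Y]Z,U⟩ − ⟨η_{T(X,Y)}Z,U⟩ (equation 3.11, the relation between the canonical Hermitian curvature and the Riemannian curvature in the parallel-torsion case). Fix an orthonormal basis {e₁,...,e₂ₙ} of V and set ρ̄(Z,U) = Σᵢ R̄(eᵢ, Jeᵢ, Z, U), ρ*(Z,U) = (1/2) Σᵢ R(eᵢ, Jeᵢ, Z, U), and Ψ(Z,U) = 4 Σᵢ ⟨η_{eᵢ}(JZ), η_{eᵢ}U⟩. Then ρ̄(Z,U) = 2ρ*(Z,U) − (1/2)Ψ(Z,U) for all Z,U ∈ V. (Algebraic content of Lemma 6.1(ii): combined with the Weitzenböck identity ρ* = ρ + (1/2)Ψ it gives ρ̄ = 2ρ + (1/2)Ψ.) -/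
open scoped RealInnerProductSpace

/-- Algebraic content of Lemma 6.1(ii): with
`R̄(X,Y,Z,U) = R(X,Y,Z,U) + ⟨[η_X,η_Y]Z,U⟩ − ⟨η_{T(X,Y)}Z,U⟩`,
`ρ̄(Z,U) = Σᵢ R̄(eᵢ, Jeᵢ, Z, U)`, `ρ*(Z,U) = (1/2) Σᵢ R(eᵢ, Jeᵢ, Z, U)` and
`Ψ(Z,U) = 4 Σᵢ ⟨η_{eᵢ}(JZ), η_{eᵢ}U⟩`, one has `ρ̄ = 2ρ* − (1/2)Ψ`. -/
theorem stmt_16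
    {V : Type*} [NormedAddCommGroup V] [InnerProductSpace ℝ V] [FiniteDimensional ℝ V]
    (J : V →ₗ[ℝ] V)
    (hJiso : ∀ x y : V, ⟪J x, J y⟫ = ⟪x, y⟫)
    (hJ2 : ∀ x : V, J (J x) = -x)
    -- η is a quasi-Kähler torsion-type tensor
    (η : V →ₗ[ℝ] (V →ₗ[ℝ] V))
    (hηskew : ∀ X x y : V, ⟪η X x, y⟫ = -⟪x, η X y⟫)
    (hηanti : ∀ X x : V, η X (J x) = - J (η X x))
    (hηQK : ∀ X x : V, η (J X) x = - J (η X x))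
    -- V has dimension 2n with an orthonormal basis e
    (n : ℕ) (hdim : Module.finrank ℝ V = 2 * n)
    (e : OrthonormalBasis (Fin (2 * n)) ℝ V)
    -- R is any quadrilinear map
    (R : V →ₗ[ℝ] V →ₗ[ℝ] V →ₗ[ℝ] V →ₗ[ℝ] ℝ) :
    ∀ Z U : V,
      (∑ i : Fin (2 * n),
        (R (e i) (J (e i)) Z U
          + ⟪η (e i) (η (J (e i)) Z) - η (J (e i)) (η (e i) Z), U⟫
          - ⟪η (η (e i) (J (e i)) - η (J (e i)) (e i)) Z, U⟫))
      = 2 * ((1 / 2 : ℝ) * ∑ i : Fin (2 * n), R (e i) (J (e i)) Z U)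
        - (1 / 2 : ℝ) * (4 * ∑ i : Fin (2 * n), ⟪η (e i) (J Z), η (e i) U⟫) := by
  intro Z U
  have term : ∀ X : V,
      R X (J X) Z U + ⟪η X (η (J X) Z) - η (J X) (η X Z), U⟫
        - ⟪η (η X (J X) - η (J X) X) Z, U⟫
      = R X (J X) Z U - 2 * ⟪η X (J Z), η X U⟫ := by
    intro X
    have torsion : η X (J X) - η (J X) X = 0 := by rw [hηanti, hηQK, sub_self]
    have commutator : η X (η (J X) Z) - η (J X) (η X Z) = (2 : ℝ) • η X (η X (J Z)) := by
      simp only [hηQK, hηanti, map_neg]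
      module
    have skew : ⟪η X (η X (J Z)), U⟫ = -⟪η X (J Z), η X U⟫ := hηskew X _ U
    rw [torsion, commutator, real_inner_smul_left, skew]
    simp only [map_zero, LinearMap.zero_apply, inner_zero_left]
    ring
  simp only [term, Finset.sum_sub_distrib, ← Finset.mul_sum]
  ring
end

section
/- Let W be a real inner product space and let ρ, Φ, Ψ ∈ W satisfy: (1) 4⟨ρ, Φ − Ψ⟩ = ‖Φ‖² + ‖Ψ‖² (Sekigawa's formula in the parallel-torsion almost Kähler case), (2) 4⟨ρ, Φ + Ψ⟩ + ⟨Ψ, Φ + Ψ⟩ = 0 (the relation coming from ρ̄·η = 0), and (3) 2⟨ρ, Φ⟩ = ⟨ρ, Ψ⟩. Then Φ = 0 and Ψ = 0. (This is the key computation in the proof of Proposition 6.1/Theorem 1.2: from (1)–(3) one derives 3‖Φ‖² + 2‖Ψ‖² = ⟨Φ,Ψ⟩, which forces Φ = Ψ = 0 by the Cauchy–Schwarz inequality; applied with W the space of 2-forms, Φ the semipositive form Φ(X,Y) = ⟨∇_{JX}ω, ∇_Y ω⟩, Ψ = ⟨(rJ)·,·⟩ and ρ the Ricci form, it shows that an Einstein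 almost Kähler manifold with parallel torsion is Kähler, and that the canonical Hermitian connection of a non-Kähler almost Kähler manifold with parallel torsion has reducible holonomy.) -/
open scoped RealInnerProductSpace

/-- Key computation in the proof of Proposition 6.1/Theorem 1.2: if
`4⟨ρ, Φ − Ψ⟩ = ‖Φ‖² + ‖Ψ‖²`, `4⟨ρ, Φ + Ψ⟩ + ⟨Ψ, Φ + Ψ⟩ = 0` and `2⟨ρ, Φ⟩ = ⟨ρ, Ψ⟩`,
then `Φ = 0` and `Ψ = 0`. -/
theorem stmt_17
    {W : Type*} [NormedAddCommGroup W] [InnerProductSpace ℝ W]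
    (ρ Φ Ψ : W)
    (h1 : 4 * ⟪ρ, Φ - Ψ⟫ = ‖Φ‖ ^ 2 + ‖Ψ‖ ^ 2)
    (h2 : 4 * ⟪ρ, Φ + Ψ⟫ + ⟪Ψ, Φ + Ψ⟫ = 0)
    (h3 : 2 * ⟪ρ, Φ⟫ = ⟪ρ, Ψ⟫) :
    Φ = 0 ∧ Ψ = 0 := by
  rw [inner_sub_right] at h1
  rw [inner_add_right, inner_add_right, real_inner_self_eq_norm_sq] at h2
  have key : 3 * ‖Φ‖ ^ 2 + 2 * ‖Ψ‖ ^ 2 = ⟪Φ, Ψ⟫ := by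
    linarith [real_inner_comm Φ Ψ]
  have cauchy : ⟪Φ, Ψ⟫ ≤ ‖Φ‖ * ‖Ψ‖ := real_inner_le_norm Φ Ψ
  constructor
  · rw [← norm_eq_zero, ← sq_eq_zero_iff]
    nlinarith [sq_nonneg (‖Φ‖ - ‖Ψ‖), sq_nonneg ‖Φ‖, sq_nonneg ‖Ψ‖]
  · rw [← norm_eq_zero, ← sq_eq_zero_iff]
    nlinarith [sq_nonneg (‖Φ‖ - ‖Ψ‖), sq_nonneg ‖Φ‖, sq_nonneg ‖Ψ‖]
end
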